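/- Let G₂ be the simple graph on vertex set {1,…,8} with edge set E₂ = {{1,7},{1,2},{2,4},{4,5},{5,7},{7,8},{2,8},{2,5},{3,5},{3,6},{6,8}}. Then Σ_{S ⊆ E₂, (V,S) connected} (−1)^{|S|−7} = 48, where the sum ranges over those subsets S of E₂ for which the spanning subgraph ({1,…,8}, S) is connected. (This is the evaluation T_{G₂}(1,0) = 48 of the Tutte polynomial, so the Euler characteristic (−1)⁷ T_{G₂}(1,0) of the complement of the associated elliptic arrangement equals −48.) -/

import Mathlib

open Finset SimpleGraph MvPolynomial

/-- Edge set of the first Schwärzler graph `G₁` on vertices `{1,…,8}`,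
encoded on `Fin 8` via `i ↦ i - 1`. -/
def E1 : Finset (Sym2 (Fin 8)) :=
  {s(0,6), s(0,1), s(1,2), s(2,3), s(3,4), s(4,5), s(5,6), s(6,7), s(1,7), s(1,4), s(4,7)}

/-- Edge set of the second Schwärzler graph `G₂` on vertices `{1,…,8}`,
encoded on `Fin 8` via `i ↦ i - 1`. -/
def E2 : Finset (Sym2 (Fin 8)) :=
  {s(0,6), s(0,1), s(1,3), s(3,4), s(4,6), s(6,7), s(1,7), s(1,4), s(2,4), s(2,5), s(5,7)}

/-- The number of connected components of the spanning subgraph of the complete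
graph on `Fin 8` with edge set `S`. -/
noncomputable def numComp (S : Finset (Sym2 (Fin 8))) : ℕ :=
  Nat.card (SimpleGraph.fromEdgeSet (↑S : Set (Sym2 (Fin 8)))).ConnectedComponent

/-- The (matroid) rank of an edge subset `S`: `8` minus the number of connected
components of the spanning subgraph `(V, S)`. -/
noncomputable def rk (S : Finset (Sym2 (Fin 8))) : ℕ := 8 - numComp S

instance (s : Set (Sym2 (Fin 8))) [DecidablePred (· ∈ s)] :
    DecidableRel (SimpleGraph.fromEdgeSet s).Adj := fun a b =>
  decidable_of_iff (s(a, b) ∈ s ∧ a ≠ b) (SimpleGraph.fromEdgeSet_adj s).symm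

/-- `c` labels the vertices so that two vertices share a label exactly when they lie in the same
connected component of the graph with edge set `S`. -/
def IsComponentLabelling {V : Type*} (S : Finset (Sym2 V)) (c : V → V) : Prop :=
  ∀ u v, c u = c v ↔ (fromEdgeSet (S : Set (Sym2 V))).Reachable u v

/-- Give the vertices labelled like `a` the label of `b`. -/
def mergeLabels {V : Type*} [DecidableEq V] (c : V → V) (a b : V) : V → V :=
  fun v => if c v = c a then c b else c v

theorem isComponentLabelling_empty {V : Type*} :
    IsComponentLabelling (∅ : Finset (Sym2 V)) id := by
  intro u v
  simp

theorem IsComponentLabelling.insert {V : Type*} [DecidableEq V] {S : Finset (Sym2 V)}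
    {c : V → V} (h : IsComponentLabelling S c) {a b : V} (hab : a ≠ b) :
    IsComponentLabelling (insert s(a, b) S) (mergeLabels c a b) := by
  intro u v
  have mono : ∀ {x y}, c x = c y →
      (fromEdgeSet ((Insert.insert s(a, b) S : Finset (Sym2 V)) : Set (Sym2 V))).Reachable x y :=
    fun hxy => ((h _ _).1 hxy).mono (fromEdgeSet_mono (by simp))
  have edge :
      (fromEdgeSet ((Insert.insert s(a, b) S : Finset (Sym2 V)) : Set (Sym2 V))).Reachable a b :=
    Adj.reachable (by simp [hab])
  constructor
  · intro huv
    unfold mergeLabels at huv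
    split_ifs at huv with hu hv hv
    · exact mono (hu.trans hv.symm)
    · exact ((mono hu).trans edge).trans (mono huv)
    · exact ((mono huv).trans edge.symm).trans (mono hv.symm)
    · exact mono huv
  · rintro ⟨p⟩
    induction p with
    | nil => rfl
    | @cons x y z hxy _ ih =>
      refine Eq.trans ?_ ih
      simp only [fromEdgeSet_adj, coe_insert, Set.mem_insert_iff, mem_coe] at hxy
      obtain ⟨hxy | hxy, hne⟩ := hxy
      · rcases Sym2.eq_iff.1 hxy with ⟨rfl, rfl⟩ | ⟨rfl, rfl⟩ <;> simp [mergeLabels]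
      · have : c x = c y := (h x y).2 (Adj.reachable (by simp [hxy, hne]))
        simp [mergeLabels, this]

/-- The sum over all sublists of `l` of the signs of the connected edge sets obtained by adding
the sublist to a set of `n` edges with component labelling `c`. -/
def signedConnectedCount {m : ℕ} :
    List (Fin (m + 1) × Fin (m + 1)) → (Fin (m + 1) → Fin (m + 1)) → ℕ → ℤ
  | [], c, n => if ∀ v, c v = c 0 then (-1) ^ (n - m) else 0
  | e :: l, c, n => signedConnectedCount l c n +
      signedConnectedCount l (mergeLabels c e.1 e.2) (n + 1)

theorem sum_powerset_eq_signedConnectedCount {m : ℕ}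
    (f : Finset (Sym2 (Fin (m + 1))) → ℤ)
    (connected : ∀ S : Finset (Sym2 (Fin (m + 1))), (fromEdgeSet (S : Set (Sym2 (Fin (m + 1))))).Connected →
      f S = (-1) ^ (S.card - m))
    (disconnected : ∀ S : Finset (Sym2 (Fin (m + 1))), ¬ (fromEdgeSet (S : Set (Sym2 (Fin (m + 1))))).Connected → f S = 0)
    (l : List (Fin (m + 1) × Fin (m + 1))) (S : Finset (Sym2 (Fin (m + 1))))
    (c : Fin (m + 1) → Fin (m + 1)) (hc : IsComponentLabelling S c)
    (loopless : ∀ e ∈ l, e.1 ≠ e.2) (nodup : (l.map fun e => s(e.1, e.2)).Nodup)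
    (disjoint : ∀ e ∈ l, s(e.1, e.2) ∉ S) :
    ∑ T ∈ (l.map fun e => s(e.1, e.2)).toFinset.powerset, f (S ∪ T) =
      signedConnectedCount l c S.card := by
  induction l generalizing S c with
  | nil =>
    have key : (∀ v, c v = c 0) ↔ (fromEdgeSet (S : Set (Sym2 (Fin (m + 1))))).Connected := by
      rw [connected_iff]
      constructor
      · exact fun hv => ⟨fun x y => (hc x y).1 ((hv x).trans (hv y).symm), inferInstance⟩
      · exact fun hv x => (hc x 0).2 (hv.1 x 0)
    by_cases hS : (fromEdgeSet (S : Set (Sym2 (Fin (m + 1))))).Connected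
    · simp [signedConnectedCount, connected S hS, if_pos (key.2 hS)]
    · simp [signedConnectedCount, disconnected S hS, if_neg (mt key.1 hS)]
  | cons e l ih =>
    simp only [List.map_cons, List.nodup_cons] at nodup
    simp only [List.forall_mem_cons] at loopless disjoint
    rw [List.map_cons, List.toFinset_cons, sum_powerset_insert (by simpa using nodup.1),
      signedConnectedCount, ih S c hc loopless.2 nodup.2 disjoint.2,
      ← card_insert_of_notMem disjoint.1,
      ← ih _ _ (hc.insert loopless.1) loopless.2 nodup.2]
    · simp only [union_insert, insert_union]
    · intro e' he' hmem
      rcases mem_insert.1 hmem with heq | hmem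
      · exact nodup.1 (heq ▸ List.mem_map_of_mem (f := fun e => s(e.1, e.2)) he')
      · exact disjoint.2 e' he' hmem

/-- The signed count of connected spanning subgraphs of `G₂` (i.e. the Tutte
evaluation `T_{G₂}(1,0)`) equals `48`; hence the Euler characteristic of the
complement of the associated elliptic arrangement is `(-1)^7 · 48 = -48`. -/
theorem signed_connected_count_G2 :
    (∑ S ∈ E2.powerset.filter
        (fun (S : Finset (Sym2 (Fin 8))) => (SimpleGraph.fromEdgeSet (↑S : Set (Sym2 (Fin 8)))).Connected),
      (-1 : ℤ) ^ (S.card - 7)) = 48 := by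
  let l : List (Fin 8 × Fin 8) := [(0,6), (0,1), (1,3), (3,4), (4,6), (6,7), (1,7), (1,4), (2,4),
    (2,5), (5,7)]
  have edges : E2 = (l.map fun e => s(e.1, e.2)).toFinset := by simp [l, E2]
  have count : signedConnectedCount l id 0 = 48 := by decide +kernel
  rw [sum_filter, edges, ← count]
  classical
  have key := sum_powerset_eq_signedConnectedCount
    (fun S => if (fromEdgeSet (S : Set (Sym2 (Fin 8)))).Connected then (-1) ^ (S.card - 7) else 0)
    (fun S hS => if_pos hS) (fun S hS => if_neg hS) l ∅ id isComponentLabelling_empty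
    (by decide) (by decide) (by simp)
  simp only [empty_union, card_empty] at key
  convert key
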